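/- Let L = 4, let L' ≥ 2 and K ∈ ℕ, K ≥ 2. There exist channels W_1,…,W_K ∈ 𝒲([4],[L']) such that: (1) for every p ∈ 𝔓_>([4]) and all i ≠ j ∈ [K], the bivariate marginal of the output distribution q = (W_1⊗…⊗W_K) p^{(K)} on coordinates (i,j) is not equal to the product of its two single-coordinate marginals (equivalently, the mutual information I(Y_i;Y_j) of the output random variables is strictly positive); and yet (2) the map p ↦ (W_1⊗…⊗W_K) p^{(K)} is not injective on 𝔓_>([4]), so p cannot be inferred from the output. -/

import Mathlib

open scoped BigOperators

/-- `p` is a probability distribution on `Fin L`. -/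
def probDist {L : ℕ} (p : Fin L → ℝ) : Prop :=
  (∀ i, 0 ≤ p i) ∧ ∑ i, p i = 1

/-- `p` is a probability distribution on `Fin L` with all entries strictly positive. -/
def probPos {L : ℕ} (p : Fin L → ℝ) : Prop :=
  (∀ i, 0 < p i) ∧ ∑ i, p i = 1

/-- `p^{(K)}`: the function on `[L]^K` equal to `p i` on the constant tuple `(i,…,i)`
and `0` elsewhere. -/
def diagEmbed {L : ℕ} (p : Fin L → ℝ) (K : ℕ) : (Fin K → Fin L) → ℝ :=
  fun y => ∑ i, if (∀ k, y k = i) then p i else 0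

/-- The action of `X_1 ⊗ … ⊗ X_K` on functions `[L]^K → ℝ`. -/
def tensorAct {L L' K : ℕ} (X : Fin K → Matrix (Fin L') (Fin L) ℝ)
    (v : (Fin K → Fin L) → ℝ) : (Fin K → Fin L') → ℝ :=
  fun y => ∑ x : Fin K → Fin L, v x * ∏ k, X k (y k) (x k)

/-- A channel from `[L]` to `[L']`: an `L' × L` column-stochastic matrix. -/
def isChannel {L L' : ℕ} (W : Matrix (Fin L') (Fin L) ℝ) : Prop :=
  (∀ i j, 0 ≤ W i j) ∧ ∀ j, ∑ i, W i j = 1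

/-- The marginal of `q : [L']^K → ℝ` on the pair of coordinates `(i, j)`. -/
def pairMarginal {L' K : ℕ} (q : (Fin K → Fin L') → ℝ) (i j : Fin K) :
    Fin L' → Fin L' → ℝ :=
  fun a b => ∑ y : Fin K → Fin L', if y i = a ∧ y j = b then q y else 0

/-- The marginal of `q : [L']^K → ℝ` on the single coordinate `i`. -/
def singleMarginal {L' K : ℕ} (q : (Fin K → Fin L') → ℝ) (i : Fin K) :
    Fin L' → ℝ :=
  fun a => ∑ y : Fin K → Fin L', if y i = a then q y else 0

/-- The deterministic channel induced by a map `f : [L] → [L']`. -/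
def deterministicChannel {L L' : ℕ} (f : Fin L → Fin L') : Matrix (Fin L') (Fin L) ℝ :=
  fun a x => if a = f x then 1 else 0

lemma isChannel_deterministicChannel {L L' : ℕ} (f : Fin L → Fin L') :
    isChannel (deterministicChannel f) := by
  refine ⟨fun i j => ?_, fun j => ?_⟩
  · unfold deterministicChannel
    split_ifs <;> norm_num
  · simp [deterministicChannel]

lemma tensorAct_diagEmbed {L L' K : ℕ} (X : Fin K → Matrix (Fin L') (Fin L) ℝ)
    (p : Fin L → ℝ) (y : Fin K → Fin L') :
    tensorAct X (diagEmbed p K) y = ∑ i, p i * ∏ k, X k (y k) i := by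
  simp only [tensorAct, diagEmbed, Finset.sum_mul]
  rw [Finset.sum_comm]
  refine Finset.sum_congr rfl fun i _ => ?_
  rw [Finset.sum_eq_single (fun _ => i)]
  · simp
  · intro x _ hx
    rw [if_neg (fun h => hx (funext h)), zero_mul]
  · simp

lemma tensorAct_deterministicChannel {L L' K : ℕ} (f : Fin L → Fin L')
    (p : Fin L → ℝ) (y : Fin K → Fin L') :
    tensorAct (fun _ => deterministicChannel f) (diagEmbed p K) y
      = ∑ x, if y = fun _ => f x then p x else 0 := by
  rw [tensorAct_diagEmbed]
  refine Finset.sum_congr rfl fun x _ => ?_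
  simp [deterministicChannel, Finset.prod_ite_zero, funext_iff]

lemma pairMarginal_deterministicChannel {L L' K : ℕ} (f : Fin L → Fin L')
    (p : Fin L → ℝ) (i j : Fin K) (a b : Fin L') :
    pairMarginal (tensorAct (fun _ => deterministicChannel f) (diagEmbed p K)) i j a b
      = ∑ x, if f x = a ∧ f x = b then p x else 0 := by
  simp only [pairMarginal, tensorAct_deterministicChannel, ← Finset.sum_filter]
  rw [Finset.sum_comm' (t' := Finset.univ.filter fun x => f x = a ∧ f x = b)
    (s' := fun x => {fun _ => f x})]
  · simp
  · intro y x
    simp only [Finset.mem_filter, Finset.mem_univ, true_and, Finset.mem_singleton]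
    constructor
    · rintro ⟨h, rfl⟩
      exact ⟨rfl, h⟩
    · rintro ⟨rfl, h⟩
      exact ⟨h, rfl⟩

lemma singleMarginal_deterministicChannel {L L' K : ℕ} (f : Fin L → Fin L')
    (p : Fin L → ℝ) (i : Fin K) (a : Fin L') :
    singleMarginal (tensorAct (fun _ => deterministicChannel f) (diagEmbed p K)) i a
      = ∑ x, if f x = a then p x else 0 := by
  simpa [pairMarginal, singleMarginal] using pairMarginal_deterministicChannel f p i i a a

theorem positivity_of_MI_not_sufficient (L' K : ℕ) (hL' : 2 ≤ L') (hK : 2 ≤ K) :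
    ∃ W : Fin K → Matrix (Fin L') (Fin 4) ℝ,
      (∀ k, isChannel (W k)) ∧
      (∀ p : Fin 4 → ℝ, probPos p → ∀ i j : Fin K, i ≠ j →
        pairMarginal (tensorAct W (diagEmbed p K)) i j
          ≠ fun a b => singleMarginal (tensorAct W (diagEmbed p K)) i a
              * singleMarginal (tensorAct W (diagEmbed p K)) j b) ∧
      (∃ p p' : Fin 4 → ℝ, probPos p ∧ probPos p' ∧ p ≠ p' ∧
        tensorAct W (diagEmbed p K) = tensorAct W (diagEmbed p' K)) := by
  obtain ⟨u, v, huv⟩ : ∃ u v : Fin L', v ≠ u :=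
    ⟨⟨0, by omega⟩, ⟨1, by omega⟩, by simp⟩
  refine ⟨fun _ => deterministicChannel ![u, u, v, v],
    fun _ => isChannel_deterministicChannel _, ?_, ?_⟩
  · rintro p ⟨hp, hsum⟩ i j - h
    have h' := congrFun (congrFun h u) u
    simp only [pairMarginal_deterministicChannel, singleMarginal_deterministicChannel] at h'
    simp [Fin.sum_univ_four, huv] at h' hsum
    have hs : 0 < (p 0 + p 1) * (p 2 + p 3) :=
      mul_pos (add_pos (hp 0) (hp 1)) (add_pos (hp 2) (hp 3))
    have hc : p 2 + p 3 = 1 - (p 0 + p 1) := by linarith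
    rw [hc] at hs
    linarith
  · refine ⟨![1/4, 1/4, 1/4, 1/4], ![1/8, 3/8, 1/4, 1/4], ⟨?_, ?_⟩, ⟨?_, ?_⟩, ?_, ?_⟩
    · intro i; fin_cases i <;> norm_num
    · simp [Fin.sum_univ_four]; norm_num
    · intro i; fin_cases i <;> norm_num
    · simp [Fin.sum_univ_four]; norm_num
    · intro h
      have := congrFun h 0
      norm_num at this
    · funext y
      simp only [tensorAct_deterministicChannel, Fin.sum_univ_four]
      by_cases h : y = fun _ => u
      · simp [h]; norm_num
      · simp [h]
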